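/- For every f ∈ 𝓗, the set Γ(f) = {x ∈ Ω(f) : f(x) < 0} is Lebesgue regular. -/

import Mathlib

open Complex MeasureTheory Set Filter Topology

/-- The class `𝓗` of analytic self-maps of the upper half-plane (allowing real constants):
`f` analytic on `ℂ⁺` with `Im f ≥ 0`. -/
def InH (f : ℂ → ℂ) : Prop :=
  DifferentiableOn ℂ f {z : ℂ | 0 < z.im} ∧ ∀ z : ℂ, 0 < z.im → 0 ≤ (f z).im

/-- The function given by the Nevanlinna formula with data `(α, β, ρ)`. -/
noncomputable def nevFun (α β : ℝ) (ρ : Measure ℝ) (z : ℂ) : ℂ :=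
  (α : ℂ) * z + (β : ℂ) + ∫ t, (1 + z * (t : ℂ)) / ((t : ℂ) - z) ∂ρ

/-- `(α, β, ρ)` is a Nevanlinna representation of `f` on `ℂ⁺`. -/
def NevRep (f : ℂ → ℂ) (α β : ℝ) (ρ : Measure ℝ) : Prop :=
  0 ≤ α ∧ IsFiniteMeasure ρ ∧ ∀ z : ℂ, 0 < z.im → f z = nevFun α β ρ z

/-- The closed support of a measure on `ℝ`. -/
def msupport (ρ : Measure ℝ) : Set ℝ := {x : ℝ | ∀ U ∈ nhds x, ρ U ≠ 0}

/-- `Ω(f) = ℝ ∖ σ(f)` for a function with Nevanlinna measure `ρ`. -/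
def NevOmega (ρ : Measure ℝ) : Set ℝ := (msupport ρ)ᶜ

/-- `Γ(f) = {x ∈ Ω(f) : f(x) < 0}`, where on `Ω(f)` the (real) values of `f` are given by
the analytic continuation, i.e. by the Nevanlinna formula. -/
def NevGamma (α β : ℝ) (ρ : Measure ℝ) : Set ℝ :=
  {x : ℝ | x ∈ NevOmega ρ ∧ (nevFun α β ρ (x : ℂ)).re < 0}

/-- An open set `O ⊆ ℝ` is Lebesgue regular if there is no point `x ∉ O` and `ε > 0` such
that `(x−ε, x+ε) ∖ O` has Lebesgue measure zero. -/
def LebesgueRegular (O : Set ℝ) : Prop :=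
  ∀ x : ℝ, ∀ ε > (0 : ℝ), volume (Set.Ioo (x - ε) (x + ε) \ O) = 0 → x ∈ O

lemma kernel_eq {t : ℝ} {z : ℂ} (h : (t : ℂ) - z ≠ 0) :
    (1 + z * (t : ℂ)) / ((t : ℂ) - z) = z + (1 + z ^ 2) / ((t : ℂ) - z) := by
  field_simp
  ring

lemma norm_kernel_le {t : ℝ} {z : ℂ} (h : (t : ℂ) - z ≠ 0) :
    ‖(1 + z * (t : ℂ)) / ((t : ℂ) - z)‖ ≤ ‖z‖ + (1 + ‖z‖ ^ 2) / ‖(t : ℂ) - z‖ := by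
  rw [kernel_eq h]
  refine (norm_add_le _ _).trans (add_le_add le_rfl ?_)
  rw [norm_div]
  gcongr
  refine (norm_add_le _ _).trans ?_
  simp

lemma measurable_kernel (z : ℂ) :
    Measurable fun t : ℝ => (1 + z * (t : ℂ)) / ((t : ℂ) - z) := by
  fun_prop

lemma im_le_norm_sub (t : ℝ) (z : ℂ) : z.im ≤ ‖(t : ℂ) - z‖ := by
  have := Complex.abs_im_le_norm ((t : ℂ) - z)
  simp only [sub_im, ofReal_im, zero_sub, abs_neg] at this
  exact (le_abs_self _).trans this

lemma integrable_kernel {ρ : Measure ℝ} [IsFiniteMeasure ρ] {z : ℂ} {d : ℝ} (hd : 0 < d)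
    (h : ∀ᵐ t : ℝ ∂ρ, d ≤ ‖(t : ℂ) - z‖) :
    Integrable (fun t : ℝ => (1 + z * (t : ℂ)) / ((t : ℂ) - z)) ρ := by
  refine Integrable.of_bound (measurable_kernel z).aestronglyMeasurable
    (‖z‖ + (1 + ‖z‖ ^ 2) / d) ?_
  filter_upwards [h] with t ht
  refine (norm_kernel_le (norm_pos_iff.1 (hd.trans_le ht))).trans ?_
  gcongr

lemma integrable_inv_norm_sq {ρ : Measure ℝ} [IsFiniteMeasure ρ] {z : ℂ} (hz : 0 < z.im) :
    Integrable (fun t : ℝ => 1 / ‖(t : ℂ) - z‖ ^ 2) ρ := by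
  refine Integrable.of_bound (Measurable.aestronglyMeasurable (by fun_prop)) (1 / z.im ^ 2)
    (Eventually.of_forall fun t => ?_)
  rw [Real.norm_of_nonneg (by positivity)]
  have := im_le_norm_sub t z
  gcongr

lemma im_kernel {t : ℝ} {z : ℂ} :
    ((1 + z * (t : ℂ)) / ((t : ℂ) - z)).im = z.im * ((1 + t ^ 2) / ‖(t : ℂ) - z‖ ^ 2) := by
  rw [Complex.div_im, ← Complex.normSq_eq_norm_sq]
  simp
  ring

/-- The imaginary part of a Nevanlinna function dominates a multiple of the Poisson integral. -/
lemma le_im_nevFun {α β : ℝ} {ρ : Measure ℝ} [IsFiniteMeasure ρ] (hα : 0 ≤ α) {z : ℂ}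
    (hz : 0 < z.im) :
    z.im * ∫ t : ℝ, 1 / ‖(t : ℂ) - z‖ ^ 2 ∂ρ ≤ (nevFun α β ρ z).im := by
  have hint : Integrable (fun t : ℝ => (1 + z * (t : ℂ)) / ((t : ℂ) - z)) ρ :=
    integrable_kernel hz (Eventually.of_forall fun t => im_le_norm_sub t z)
  have h1 : (∫ t : ℝ, (1 + z * (t : ℂ)) / ((t : ℂ) - z) ∂ρ).im =
      ∫ t : ℝ, ((1 + z * (t : ℂ)) / ((t : ℂ) - z)).im ∂ρ :=
    (Complex.imCLM.integral_comp_comm hint).symm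
  have h2 : (nevFun α β ρ z).im = α * z.im + ∫ t : ℝ, ((1 + z * (t : ℂ)) / ((t : ℂ) - z)).im ∂ρ := by
    simp [nevFun, h1]
  rw [h2, ← integral_const_mul]
  have : ∫ t : ℝ, z.im * (1 / ‖(t : ℂ) - z‖ ^ 2) ∂ρ ≤
      ∫ t : ℝ, ((1 + z * (t : ℂ)) / ((t : ℂ) - z)).im ∂ρ := by
    refine integral_mono ((integrable_inv_norm_sq hz).const_mul _)
      (Complex.imCLM.integrable_comp hint) fun t => ?_
    simp only [im_kernel]
    gcongr
    nlinarith [sq_nonneg t]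
  nlinarith [mul_nonneg hα hz.le]

lemma im_nevFun_pos {α β : ℝ} {ρ : Measure ℝ} [IsFiniteMeasure ρ] (hα : 0 ≤ α) (hρ : ρ ≠ 0)
    {z : ℂ} (hz : 0 < z.im) : 0 < (nevFun α β ρ z).im := by
  refine lt_of_lt_of_le (mul_pos hz ?_) (le_im_nevFun hα hz)
  have hpos : ∀ t : ℝ, 0 < 1 / ‖(t : ℂ) - z‖ ^ 2 := fun t => by
    have := hz.trans_le (im_le_norm_sub t z)
    positivity
  rw [integral_pos_iff_support_of_nonneg (fun t => (hpos t).le) (integrable_inv_norm_sq hz)]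
  have : Function.support (fun t : ℝ => 1 / ‖(t : ℂ) - z‖ ^ 2) = univ := by
    ext t
    simpa using (hpos t).ne'
  rw [this]
  exact Measure.measure_univ_pos.2 hρ

lemma exists_ae_le_of_mem_omega {ρ : Measure ℝ} {x : ℝ} (hx : x ∈ NevOmega ρ) :
    ∃ d > 0, ∀ᵐ t : ℝ ∂ρ, ∀ z ∈ Metric.ball (x : ℂ) d, d ≤ ‖(t : ℂ) - z‖ := by
  have : ∃ U ∈ 𝓝 x, ρ U = 0 := by simpa [NevOmega, msupport] using hx
  obtain ⟨U, hU, h0⟩ := this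
  obtain ⟨e, he, hball⟩ := Metric.mem_nhds_iff.1 hU
  refine ⟨e / 2, by positivity, ?_⟩
  have : ∀ᵐ t ∂ρ, t ∉ U := measure_eq_zero_iff_ae_notMem.1 h0
  filter_upwards [this] with t ht z hz
  have h1 : e ≤ dist t x := not_lt.1 fun h => ht (hball h)
  have h2 : dist (t : ℂ) (x : ℂ) = dist t x := by
    simp [Complex.dist_eq, Real.dist_eq, ← Complex.ofReal_sub]
  have h3 := dist_triangle (t : ℂ) z x
  rw [← dist_eq_norm]
  rw [Metric.mem_ball] at hz
  linarith

lemma continuousAt_nevFun {α β : ℝ} {ρ : Measure ℝ} [IsFiniteMeasure ρ] {x : ℝ}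
    (hx : x ∈ NevOmega ρ) : ContinuousAt (nevFun α β ρ) (x : ℂ) := by
  obtain ⟨d, hd, h⟩ := exists_ae_le_of_mem_omega hx
  unfold nevFun
  refine ContinuousAt.add (by fun_prop) ?_
  refine tendsto_integral_filter_of_dominated_convergence
    (fun _ => (‖(x : ℂ)‖ + d) + (1 + (‖(x : ℂ)‖ + d) ^ 2) / d)
    (Eventually.of_forall fun z => (measurable_kernel z).aestronglyMeasurable) ?_
    (integrable_const _) ?_
  · filter_upwards [Metric.ball_mem_nhds (x : ℂ) hd] with z hz
    filter_upwards [h] with t ht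
    have h1 := ht z hz
    have h2 : ‖z‖ ≤ ‖(x : ℂ)‖ + d := by
      have h3 := norm_add_le (x : ℂ) (z - x)
      rw [Metric.mem_ball, dist_eq_norm] at hz
      rw [add_sub_cancel] at h3
      linarith
    refine (norm_kernel_le (norm_pos_iff.1 (hd.trans_le h1))).trans ?_
    gcongr
  · filter_upwards [h] with t ht
    have h1 : (t : ℂ) - x ≠ 0 := norm_pos_iff.1 (hd.trans_le (ht x (Metric.mem_ball_self hd)))
    have : ContinuousAt (fun z : ℂ => (1 + z * (t : ℂ)) / ((t : ℂ) - z)) (x : ℂ) :=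
      ContinuousAt.div (by fun_prop) (by fun_prop) h1
    exact this

lemma nevFun_ofReal (α β : ℝ) (ρ : Measure ℝ) (x : ℝ) :
    nevFun α β ρ (x : ℂ) = ((α * x + β + ∫ t, (1 + x * t) / (t - x) ∂ρ : ℝ) : ℂ) := by
  have : (fun t : ℝ => (1 + (x : ℂ) * (t : ℂ)) / ((t : ℂ) - x)) =
      fun t : ℝ => (((1 + x * t) / (t - x) : ℝ) : ℂ) := by
    ext t
    push_cast
    rfl
  rw [nevFun, this, integral_complex_ofReal]
  push_cast
  rfl

/-- Nevanlinna functions increase on the intervals that their measure does not charge. -/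
lemma nevFun_re_mono {α β : ℝ} {ρ : Measure ℝ} [IsFiniteMeasure ρ] (hα : 0 ≤ α) {a b x y : ℝ}
    (h0 : ρ (Ioo a b) = 0) (hax : a < x) (hxy : x < y) (hyb : y < b) :
    (nevFun α β ρ (x : ℂ)).re ≤ (nevFun α β ρ (y : ℂ)).re := by
  have hae : ∀ᵐ t ∂ρ, t ∉ Ioo a b := measure_eq_zero_iff_ae_notMem.1 h0
  have hint : ∀ w ∈ Ioo a b, Integrable (fun t : ℝ => (1 + w * t) / (t - w)) ρ := by
    intro w hw
    have hd : 0 < min (w - a) (b - w) := lt_min (by linarith [hw.1]) (by linarith [hw.2])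
    have := integrable_kernel (ρ := ρ) (z := (w : ℂ)) hd (by
      filter_upwards [hae] with t ht
      rw [← Complex.ofReal_sub, Complex.norm_real, Real.norm_eq_abs]
      by_cases h : a < t
      · have : b ≤ t := not_lt.1 fun h' => ht ⟨h, h'⟩
        exact (min_le_right _ _).trans (le_trans (by linarith) (le_abs_self _))
      · exact (min_le_left _ _).trans (le_trans (by linarith) (neg_le_abs _)))
    refine (Complex.reCLM.integrable_comp this).congr (Eventually.of_forall fun t => ?_)
    have : (1 + (w : ℂ) * (t : ℂ)) / ((t : ℂ) - w) = (((1 + w * t) / (t - w) : ℝ) : ℂ) := by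
      push_cast
      rfl
    simp only [Complex.reCLM_apply, this, Complex.ofReal_re]
  rw [nevFun_ofReal, nevFun_ofReal, Complex.ofReal_re, Complex.ofReal_re]
  refine add_le_add (by nlinarith) ?_
  refine integral_mono_ae (hint x ⟨hax, hxy.trans hyb⟩) (hint y ⟨hax.trans hxy, hyb⟩) ?_
  filter_upwards [hae] with t ht
  have hprod : 0 < (t - x) * (t - y) := by
    by_cases h : a < t
    · have : b ≤ t := not_lt.1 fun h' => ht ⟨h, h'⟩
      exact mul_pos (by linarith) (by linarith)
    · exact mul_pos_of_neg_of_neg (by linarith) (by linarith)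
  have hx0 : t - x ≠ 0 := left_ne_zero_of_mul hprod.ne'
  have hy0 : t - y ≠ 0 := right_ne_zero_of_mul hprod.ne'
  have : (1 + y * t) / (t - y) - (1 + x * t) / (t - x) =
      (1 + t ^ 2) * (y - x) / ((t - x) * (t - y)) := by
    field_simp
    ring
  have h2 : 0 ≤ (1 + t ^ 2) * (y - x) / ((t - x) * (t - y)) :=
    div_nonneg (mul_nonneg (by positivity) (by linarith)) hprod.le
  linarith

lemma differentiableOn_cauchy (μ : Measure ℝ) [IsFiniteMeasure μ] :
    DifferentiableOn ℂ (fun z : ℂ => ∫ t : ℝ, 1 / ((t : ℂ) - z) ∂μ) {z : ℂ | 0 < z.im} := by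
  intro z₀ hz₀
  have hz₀ : 0 < z₀.im := hz₀
  have hs : {z : ℂ | z₀.im / 2 < z.im} ∈ 𝓝 z₀ :=
    (isOpen_lt continuous_const Complex.continuous_im).mem_nhds (half_lt_self hz₀)
  have hnorm : ∀ t : ℝ, ∀ z ∈ {z : ℂ | z₀.im / 2 < z.im}, z₀.im / 2 ≤ ‖(t : ℂ) - z‖ :=
    fun t z hz => (le_of_lt hz).trans (im_le_norm_sub t z)
  refine ((hasDerivAt_integral_of_dominated_loc_of_deriv_le (μ := μ)
    (F := fun (z : ℂ) (t : ℝ) => 1 / ((t : ℂ) - z))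
    (F' := fun z t => 1 / ((t : ℂ) - z) ^ 2) (bound := fun _ => 1 / (z₀.im / 2) ^ 2) hs
    (Eventually.of_forall fun z => Measurable.aestronglyMeasurable (by fun_prop)) ?_
    (Measurable.aestronglyMeasurable (by fun_prop)) ?_ (integrable_const _)
    ?_).2.differentiableAt).differentiableWithinAt
  · refine Integrable.of_bound (Measurable.aestronglyMeasurable (by fun_prop)) (1 / z₀.im)
      (Eventually.of_forall fun t => ?_)
    rw [norm_div, norm_one]
    have := im_le_norm_sub t z₀
    gcongr
  · refine Eventually.of_forall fun t z hz => ?_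
    rw [norm_div, norm_one, norm_pow]
    have := hnorm t z hz
    gcongr
  · refine Eventually.of_forall fun t z hz => ?_
    have h0 : (t : ℂ) - z ≠ 0 := norm_pos_iff.1 ((half_pos hz₀).trans_le (hnorm t z hz))
    have h1 : HasDerivAt (fun z : ℂ => (t : ℂ) - z) (-1) z := by
      simpa using (hasDerivAt_id z).const_sub (t : ℂ)
    simpa using h1.fun_inv h0

lemma norm_cauchy_le (μ : Measure ℝ) [IsFiniteMeasure μ] {z : ℂ} (hz : 0 < z.im) :
    ‖∫ t : ℝ, 1 / ((t : ℂ) - z) ∂μ‖ ≤ μ.real univ / z.im := by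
  have := norm_integral_le_of_norm_le_const (μ := μ) (f := fun t : ℝ => 1 / ((t : ℂ) - z))
    (C := 1 / z.im) (Eventually.of_forall fun t => by
      rw [norm_div, norm_one]
      have := im_le_norm_sub t z
      gcongr)
  exact this.trans_eq (by ring)

lemma im_cauchy (μ : Measure ℝ) [IsFiniteMeasure μ] {z : ℂ} (hz : 0 < z.im) :
    (∫ t : ℝ, 1 / ((t : ℂ) - z) ∂μ).im = ∫ t : ℝ, z.im * (1 / ‖(t : ℂ) - z‖ ^ 2) ∂μ := by
  have hint : Integrable (fun t : ℝ => 1 / ((t : ℂ) - z)) μ := by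
    refine Integrable.of_bound (Measurable.aestronglyMeasurable (by fun_prop)) (1 / z.im)
      (Eventually.of_forall fun t => ?_)
    rw [norm_div, norm_one]
    have := im_le_norm_sub t z
    gcongr
  have h1 : (∫ t : ℝ, 1 / ((t : ℂ) - z) ∂μ).im = ∫ t : ℝ, (1 / ((t : ℂ) - z)).im ∂μ :=
    (Complex.imCLM.integral_comp_comm hint).symm
  rw [h1]
  congr 1 with t
  rw [Complex.div_im, ← Complex.normSq_eq_norm_sq]
  simp
  ring

lemma im_cauchy_nonneg (μ : Measure ℝ) [IsFiniteMeasure μ] {z : ℂ} (hz : 0 < z.im) :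
    0 ≤ (∫ t : ℝ, 1 / ((t : ℂ) - z) ∂μ).im := by
  rw [im_cauchy μ hz]
  exact integral_nonneg fun t => by positivity

lemma norm_ofReal_sub_sq (t : ℝ) (z : ℂ) : ‖(t : ℂ) - z‖ ^ 2 = (t - z.re) ^ 2 + z.im ^ 2 := by
  rw [← Complex.normSq_eq_norm_sq, Complex.normSq_apply]
  simp
  ring

lemma one_le_im_cauchy {U : Set ℝ} (hU : volume U ≠ ⊤) {z : ℂ} (hz : 0 < z.im)
    (hsub : Icc (z.re - z.im) (z.re + z.im) ⊆ U) :
    1 ≤ (∫ t in U, 1 / ((t : ℂ) - z)).im := by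
  have : IsFiniteMeasure (volume.restrict U) := isFiniteMeasure_restrict.2 hU
  rw [im_cauchy _ hz]
  have hint : IntegrableOn (fun t : ℝ => z.im * (1 / ‖(t : ℂ) - z‖ ^ 2)) U :=
    (integrable_inv_norm_sq hz).const_mul _
  calc (1 : ℝ) = ∫ t in Icc (z.re - z.im) (z.re + z.im), 1 / (2 * z.im) := by
        rw [setIntegral_const, Real.volume_real_Icc_of_le (by linarith)]
        simp only [smul_eq_mul]
        field_simp
        ring
    _ ≤ ∫ t in Icc (z.re - z.im) (z.re + z.im), z.im * (1 / ‖(t : ℂ) - z‖ ^ 2) := by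
        refine setIntegral_mono_on (integrableOn_const (by simp)) (hint.mono_set hsub) measurableSet_Icc fun t ht => ?_
        have h1 : ‖(t : ℂ) - z‖ ^ 2 ≤ 2 * z.im ^ 2 := by
          rw [norm_ofReal_sub_sq]
          nlinarith [ht.1, ht.2]
        have h2 : 0 < ‖(t : ℂ) - z‖ := hz.trans_le (im_le_norm_sub t z)
        calc 1 / (2 * z.im) = z.im * (1 / (2 * z.im ^ 2)) := by field_simp
          _ ≤ _ := by gcongr
    _ ≤ _ := by
        refine setIntegral_mono_set hint (Eventually.of_forall fun t => ?_) (Eventually.of_forall hsub)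
        simp only [Pi.zero_apply]
        positivity

/-- A form of the maximum principle: a bounded harmonic function on the upper half-plane that
vanishes almost everywhere on an interval decays linearly over that interval. -/
lemma neg_im_le_of_tendsto {L : ℂ → ℂ} (hL : DifferentiableOn ℂ L {z : ℂ | 0 < z.im})
    (hb : ∀ z : ℂ, 0 < z.im → -Real.pi ≤ (L z).im) {O : Set ℝ} {x r y : ℝ}
    (hO : volume (Icc (x - r) (x + r) \ O) = 0)
    (hlim : ∀ w ∈ O, Tendsto (fun z => (L z).im) (𝓝[{z : ℂ | 0 < z.im}] (w : ℂ)) (𝓝 0))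
    (hy : 0 < y) (hyr : y < r) :
    -(L (x + y * I)).im ≤ 2 * Real.pi / r * y := by
  have hr : 0 < r := hy.trans hyr
  have hπ := Real.pi_pos
  suffices h : ∀ η > 0, -(L (x + y * I)).im ≤ 2 * Real.pi / r * y + η * (Real.pi / y + 1) by
    refine le_of_forall_pos_le_add fun e he => ?_
    have hc : 0 < Real.pi / y + 1 := by positivity
    have := h (e / (Real.pi / y + 1)) (by positivity)
    rwa [div_mul_cancel₀ _ hc.ne'] at this
  intro η hη
  obtain ⟨U, hsub, hUo, hUv⟩ := Set.exists_isOpen_lt_of_lt (μ := volume) _ (ENNReal.ofReal η)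
    (by rw [hO]; exact ENNReal.ofReal_pos.2 hη)
  have hUtop : volume U ≠ ⊤ := (hUv.trans ENNReal.ofReal_lt_top).ne
  have : IsFiniteMeasure (volume.restrict U) := isFiniteMeasure_restrict.2 hUtop
  set P : ℂ → ℂ := fun z => ∫ t in U, 1 / ((t : ℂ) - z) with hP
  have hPd : DifferentiableOn ℂ P {z : ℂ | 0 < z.im} := differentiableOn_cauchy _
  have hP0 : ∀ z : ℂ, 0 < z.im → 0 ≤ (P z).im := fun z hz => im_cauchy_nonneg _ hz
  set S : Set ℂ := {w | ∀ᶠ z in 𝓝 w, 0 < z.im → -(L z).im ≤ Real.pi * (P z).im + η} with hS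
  have hSo : IsOpen S := isOpen_setOfPred_eventually_nhds
  have hKS : Complex.ofReal '' Icc (x - r) (x + r) ⊆ S := by
    rintro _ ⟨w, hw, rfl⟩
    by_cases hwO : w ∈ O
    · have h1 := (hlim w hwO).eventually (lt_mem_nhds (neg_lt_zero.2 hη))
      rw [eventually_nhdsWithin_iff] at h1
      filter_upwards [h1] with z hz hzi
      have := hz hzi
      have := mul_nonneg hπ.le (hP0 z hzi)
      linarith
    · obtain ⟨e, he, hball⟩ := Metric.isOpen_iff.1 hUo w (hsub ⟨hw, hwO⟩)
      filter_upwards [Metric.ball_mem_nhds (w : ℂ) (half_pos he)] with z hz hzi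
      have h1 : ‖z - w‖ < e / 2 := by rwa [Metric.mem_ball, dist_eq_norm] at hz
      have h2 : |z.re - w| < e / 2 := by
        simpa using (Complex.abs_re_le_norm (z - w)).trans_lt h1
      have h3 : |z.im| < e / 2 := by simpa using (Complex.abs_im_le_norm (z - w)).trans_lt h1
      rw [abs_lt] at h2 h3
      have h4 : 1 ≤ (P z).im := by
        refine one_le_im_cauchy hUtop hzi fun t ht => hball ?_
        rw [Metric.mem_ball, Real.dist_eq, abs_lt]
        constructor <;> linarith [ht.1, ht.2]
      have := hb z hzi
      nlinarith
  obtain ⟨δ, hδ, hthick⟩ := (isCompact_Icc.image Complex.continuous_ofReal).exists_thickening_subset_open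
    hSo hKS
  obtain ⟨s, hs0, hsδ, hsy⟩ : ∃ s, 0 < s ∧ s < δ ∧ s < y :=
    ⟨min δ y / 2, by positivity, by linarith [min_le_left δ y, lt_min hδ hy],
      by linarith [min_le_right δ y, lt_min hδ hy]⟩
  set D : Set ℂ := {z | s < z.im} ∩ Metric.ball (x : ℂ) r with hD
  have hDo : IsOpen D := (isOpen_lt continuous_const Complex.continuous_im).inter Metric.isOpen_ball
  have hDc : closure D ⊆ {z | s ≤ z.im} ∩ Metric.closedBall (x : ℂ) r :=
    closure_minimal (fun z hz => ⟨show s ≤ z.im from le_of_lt hz.1, Metric.ball_subset_closedBall hz.2⟩)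
      ((isClosed_le continuous_const Complex.continuous_im).inter Metric.isClosed_closedBall)
  have hDpos : closure D ⊆ {z : ℂ | 0 < z.im} := fun z hz => hs0.trans_le (hDc hz).1
  set q : ℂ → ℂ := fun z => I * (z - x) ^ 2 + 2 * r * z with hq
  have hqim : ∀ z : ℂ, (q z).im = (z.re - x) ^ 2 - z.im ^ 2 + 2 * r * z.im := by
    intro z
    simp [hq, pow_two]
  set H : ℂ → ℂ := fun z => -L z - (Real.pi / r ^ 2 : ℝ) * q z - (Real.pi : ℝ) * P z - (η : ℝ) * I
    with hH
  have hHim : ∀ z, (H z).im = -(L z).im - Real.pi / r ^ 2 * (q z).im - Real.pi * (P z).im - η := by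
    intro z
    simp only [hH, Complex.sub_im, Complex.neg_im, Complex.im_ofReal_mul, Complex.I_im, mul_one]
  have hHd : DifferentiableOn ℂ H (closure D) := by
    have h1 := hL.mono hDpos
    have h2 := hPd.mono hDpos
    have h3 : DifferentiableOn ℂ q (closure D) := by fun_prop
    fun_prop
  have hG : ∀ z, ‖Complex.exp (-I * H z)‖ = Real.exp (H z).im := by
    intro z
    rw [Complex.norm_exp]
    simp
  have hfront : ∀ z ∈ frontier D, ‖Complex.exp (-I * H z)‖ ≤ 1 := by
    intro z hz
    rw [hG, Real.exp_le_one_iff, hHim, hqim]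
    rw [hDo.frontier_eq] at hz
    obtain ⟨hzs, hzr⟩ := hDc hz.1
    have hzs : s ≤ z.im := hzs
    have hzi : 0 < z.im := hs0.trans_le hzs
    have hnorm : ‖z - x‖ ^ 2 = (z.re - x) ^ 2 + z.im ^ 2 := by
      rw [← Complex.normSq_eq_norm_sq, Complex.normSq_apply]
      simp
      ring
    have hzr : ‖z - x‖ ≤ r := by rwa [Metric.mem_closedBall, dist_eq_norm] at hzr
    have him : z.im ≤ r := by
      have := Complex.abs_im_le_norm (z - x)
      simp only [Complex.sub_im, Complex.ofReal_im, sub_zero] at this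
      linarith [le_abs_self z.im]
    have hre : |z.re - x| ≤ r := by simpa using (Complex.abs_re_le_norm (z - x)).trans hzr
    have hPz := mul_nonneg hπ.le (hP0 z hzi)
    by_cases hsz : s < z.im
    · have hrz : ‖z - x‖ = r := by
        refine le_antisymm hzr (not_lt.1 fun h => hz.2 ⟨hsz, ?_⟩)
        rwa [Metric.mem_ball, dist_eq_norm]
      have h1 : r ^ 2 ≤ (z.re - x) ^ 2 - z.im ^ 2 + 2 * r * z.im := by
        rw [hrz] at hnorm
        nlinarith
      have h2 : Real.pi ≤ Real.pi / r ^ 2 * ((z.re - x) ^ 2 - z.im ^ 2 + 2 * r * z.im) := by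
        calc Real.pi = Real.pi / r ^ 2 * r ^ 2 := by field_simp
          _ ≤ _ := by gcongr
      have := hb z hzi
      linarith
    · have hsz : z.im = s := le_antisymm (not_lt.1 hsz) hzs
      have hzS : z ∈ S := by
        refine hthick (Metric.mem_thickening_iff.2 ⟨(z.re : ℂ), ⟨z.re, ?_, rfl⟩, ?_⟩)
        · rw [abs_le] at hre
          constructor <;> linarith
        · have : z - z.re = (z.im : ℂ) * I := by
            apply Complex.ext <;> simp
          rw [dist_eq_norm, this]
          simp [abs_of_pos hzi]
          linarith
      have h1 := hzS.self_of_nhds hzi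
      have h2 : 0 ≤ Real.pi / r ^ 2 * ((z.re - x) ^ 2 - z.im ^ 2 + 2 * r * z.im) := by
        refine mul_nonneg (by positivity) ?_
        nlinarith [sq_nonneg (z.re - x)]
      linarith
  have hmem : (x + y * I : ℂ) ∈ D := by
    refine ⟨by simpa using hsy, ?_⟩
    rw [Metric.mem_ball, dist_eq_norm]
    simpa [abs_of_pos hy] using hyr
  have hmax := Complex.norm_le_of_forall_mem_frontier_norm_le
    (Metric.isBounded_ball.subset inter_subset_right)
    (DifferentiableOn.diffContOnCl (f := fun z => Complex.exp (-I * H z))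
      ((hHd.const_mul (-I)).cexp)) hfront (subset_closure hmem)
  rw [hG, Real.exp_le_one_iff, hHim, hqim] at hmax
  have hzi : 0 < (x + y * I : ℂ).im := by simpa using hy
  have hPle : (P (x + y * I)).im ≤ η / y := by
    have h1 := (Complex.abs_im_le_norm _).trans (norm_cauchy_le (volume.restrict U) hzi)
    have h2 : (volume.restrict U).real univ ≤ η := by
      rw [Measure.real, Measure.restrict_apply_univ]
      exact ENNReal.toReal_le_of_le_ofReal hη.le hUv.le
    refine ((le_abs_self _).trans h1).trans ?_
    simp only [Complex.add_im, Complex.ofReal_im, Complex.im_ofReal_mul, Complex.I_im, mul_one,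
      zero_add]
    gcongr
  have h2 : Real.pi / r ^ 2 * (2 * r * y - y ^ 2) ≤ 2 * Real.pi / r * y := by
    calc Real.pi / r ^ 2 * (2 * r * y - y ^ 2) ≤ Real.pi / r ^ 2 * (2 * r * y) := by
          gcongr
          nlinarith
      _ = _ := by field_simp
  have h3 : Real.pi * (P (x + y * I)).im ≤ Real.pi * (η / y) := by gcongr
  have h4 : η * (Real.pi / y + 1) = Real.pi * (η / y) + η := by ring
  simp only [Complex.add_im, Complex.ofReal_im, Complex.im_ofReal_mul, Complex.I_im, mul_one,
    zero_add, Complex.add_re, Complex.ofReal_re, Complex.re_ofReal_mul, Complex.I_re, mul_zero,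
    add_zero, sub_self] at hmax
  rw [h4]
  have h5 : Real.pi / r ^ 2 * (0 ^ 2 - y ^ 2 + 2 * r * y) =
    Real.pi / r ^ 2 * (2 * r * y - y ^ 2) := by ring
  linarith

lemma measure_Icc_le {ρ : Measure ℝ} [IsFiniteMeasure ρ] {x y D : ℝ} (hy : 0 < y)
    (h : ∫ t : ℝ, 1 / ‖(t : ℂ) - (x + y * I)‖ ^ 2 ∂ρ ≤ D) :
    ρ.real (Icc (x - y) (x + y)) ≤ 2 * D * y ^ 2 := by
  have hzi : 0 < (x + y * I : ℂ).im := by simpa using hy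
  have hint := integrable_inv_norm_sq (ρ := ρ) hzi
  have h1 : ∫ t in Icc (x - y) (x + y), 1 / (2 * y ^ 2) ∂ρ ≤
      ∫ t in Icc (x - y) (x + y), 1 / ‖(t : ℂ) - (x + y * I)‖ ^ 2 ∂ρ := by
    refine setIntegral_mono_on (integrableOn_const (by simp)) hint.integrableOn
      measurableSet_Icc fun t ht => ?_
    have h2 := hzi.trans_le (im_le_norm_sub t (x + y * I))
    have h3 : ‖(t : ℂ) - (x + y * I)‖ ^ 2 ≤ 2 * y ^ 2 := by
      rw [norm_ofReal_sub_sq]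
      simp
      nlinarith [ht.1, ht.2]
    gcongr
  have h2 : ∫ t in Icc (x - y) (x + y), 1 / ‖(t : ℂ) - (x + y * I)‖ ^ 2 ∂ρ ≤
      ∫ t : ℝ, 1 / ‖(t : ℂ) - (x + y * I)‖ ^ 2 ∂ρ :=
    setIntegral_le_integral hint (Eventually.of_forall fun t => by simp only [Pi.zero_apply]; positivity)
  rw [setIntegral_const, smul_eq_mul, mul_one_div] at h1
  have h3 := (h1.trans h2).trans h
  rw [div_le_iff₀ (by positivity)] at h3
  linarith

lemma measure_Ioo_eq_zero_of_quadratic {ρ : Measure ℝ} [IsFiniteMeasure ρ] {x₀ r C : ℝ}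
    (hr : 0 < r)
    (h : ∀ x ∈ Ioo (x₀ - r) (x₀ + r), ∀ y ∈ Ioo 0 r, ρ.real (Icc (x - y) (x + y)) ≤ C * y ^ 2) :
    ρ (Ioo (x₀ - r) (x₀ + r)) = 0 := by
  have hbound : ∀ n : ℕ, ρ.real (Ioo (x₀ - r) (x₀ + r)) ≤ C * r ^ 2 / ((n + 2 : ℕ) : ℝ) := by
    intro n
    set m : ℕ := n + 2 with hm
    have hm2 : (2 : ℝ) ≤ m := by rw [hm]; push_cast; linarith [Nat.cast_nonneg (α := ℝ) n]
    have hm0 : (0 : ℝ) < m := by linarith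
    have hy0 : 0 < r / m := by positivity
    have hyr : r / m < r := by
      rw [div_lt_iff₀ hm0]
      nlinarith
    have hmr : m * (r / m) = r := by field_simp
    set y := r / m with hy
    have hcov : Ioo (x₀ - r) (x₀ + r) ⊆ ⋃ k ∈ Finset.range m,
        Icc (x₀ - r + (2 * (k : ℝ) + 1) * y - y) (x₀ - r + (2 * (k : ℝ) + 1) * y + y) := by
      intro t ht
      have hu : 0 ≤ (t - (x₀ - r)) / (2 * y) := div_nonneg (by linarith [ht.1]) (by positivity)
      have h1 := Nat.floor_le hu
      have h2 := Nat.lt_floor_add_one ((t - (x₀ - r)) / (2 * y))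
      have hlt : (t - (x₀ - r)) / (2 * y) < m := by
        rw [div_lt_iff₀ (by positivity)]
        nlinarith [ht.2]
      rw [le_div_iff₀ (by positivity)] at h1
      rw [div_lt_iff₀ (by positivity)] at h2
      simp only [mem_iUnion]
      refine ⟨⌊(t - (x₀ - r)) / (2 * y)⌋₊, Finset.mem_range.2 ((Nat.floor_lt hu).2 hlt), ?_, ?_⟩ <;>
        linarith
    calc ρ.real (Ioo (x₀ - r) (x₀ + r)) ≤ _ := measureReal_mono hcov (measure_ne_top _ _)
      _ ≤ ∑ k ∈ Finset.range m, _ := measureReal_biUnion_finset_le _ _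
      _ ≤ ∑ k ∈ Finset.range m, C * y ^ 2 := by
          refine Finset.sum_le_sum fun k hk => h _ ⟨?_, ?_⟩ y ⟨hy0, hyr⟩
          · have : 0 < (2 * (k : ℝ) + 1) * y := by positivity
            linarith
          · have hk1 : (k : ℝ) + 1 ≤ m := by exact_mod_cast Finset.mem_range.1 hk
            nlinarith
      _ = C * r ^ 2 / m := by
          rw [Finset.sum_const, Finset.card_range, nsmul_eq_mul, hy]
          field_simp
  have hlim : Tendsto (fun n : ℕ => C * r ^ 2 / ((n + 2 : ℕ) : ℝ)) atTop (𝓝 0) :=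
    (tendsto_const_div_atTop_nhds_zero_nat (C * r ^ 2)).comp (tendsto_add_atTop_nat 2)
  have h0 : ρ.real (Ioo (x₀ - r) (x₀ + r)) ≤ 0 := ge_of_tendsto' hlim hbound
  exact (measureReal_eq_zero_iff (by simp)).1 (le_antisymm h0 measureReal_nonneg)

lemma norm_nevFun_le {α β : ℝ} {ρ : Measure ℝ} [IsFiniteMeasure ρ] (hα : 0 ≤ α) {z : ℂ}
    (hz : 0 < z.im) {R : ℝ} (hR : ‖z‖ ≤ R) {c : ℝ} (hc : 0 < c) :
    c * ‖nevFun α β ρ z‖ ≤ c * (α * R + |β|) + (c * R + (c * (1 + R ^ 2)) ^ 2 / 2) * ρ.real univ +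
      (∫ t : ℝ, 1 / ‖(t : ℂ) - z‖ ^ 2 ∂ρ) / 2 := by
  have h1 : ‖nevFun α β ρ z‖ ≤ (α * R + |β|) + ‖∫ t : ℝ, (1 + z * (t : ℂ)) / ((t : ℂ) - z) ∂ρ‖ := by
    refine (norm_add_le _ _).trans (add_le_add ((norm_add_le _ _).trans (add_le_add ?_ ?_)) le_rfl)
    · rw [norm_mul, Complex.norm_real, Real.norm_of_nonneg hα]
      gcongr
    · rw [Complex.norm_real, Real.norm_eq_abs]
  have hi := integrable_inv_norm_sq (ρ := ρ) hz
  set A := c * (1 + R ^ 2) with hA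
  have h2 : ‖∫ t : ℝ, (1 + z * (t : ℂ)) / ((t : ℂ) - z) ∂ρ‖ ≤
      ∫ t : ℝ, (R + A ^ 2 / (2 * c)) + 1 / (2 * c) * (1 / ‖(t : ℂ) - z‖ ^ 2) ∂ρ := by
    refine norm_integral_le_of_norm_le ((integrable_const _).add (hi.const_mul _))
      (Eventually.of_forall fun t => ?_)
    have ht : 0 < ‖(t : ℂ) - z‖ := hz.trans_le (im_le_norm_sub t z)
    refine (norm_kernel_le (norm_pos_iff.1 ht)).trans ?_
    have h3 : (1 + ‖z‖ ^ 2) / ‖(t : ℂ) - z‖ ≤ A / c * (1 / ‖(t : ℂ) - z‖) := by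
      rw [hA, mul_div_cancel_left₀ _ hc.ne', mul_one_div]
      gcongr
    have h4 : A / c * (1 / ‖(t : ℂ) - z‖) ≤
        A ^ 2 / (2 * c) + 1 / (2 * c) * (1 / ‖(t : ℂ) - z‖ ^ 2) := by
      have : A ^ 2 / (2 * c) + 1 / (2 * c) * (1 / ‖(t : ℂ) - z‖ ^ 2) -
          A / c * (1 / ‖(t : ℂ) - z‖) = (A - 1 / ‖(t : ℂ) - z‖) ^ 2 / (2 * c) := by
        field_simp
        ring
      have h5 : 0 ≤ (A - 1 / ‖(t : ℂ) - z‖) ^ 2 / (2 * c) := by positivity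
      linarith
    linarith
  rw [integral_add (integrable_const _) (hi.const_mul _), integral_const, integral_const_mul,
    smul_eq_mul] at h2
  calc c * ‖nevFun α β ρ z‖ ≤ c * ((α * R + |β|) + (ρ.real univ * (R + A ^ 2 / (2 * c)) +
        1 / (2 * c) * ∫ t : ℝ, 1 / ‖(t : ℂ) - z‖ ^ 2 ∂ρ)) := by
        gcongr
        exact h1.trans (add_le_add le_rfl h2)
    _ = _ := by
        field_simp
        ring

/-- If `Im f = O(y |f|)` near an interval, then the measure does not charge the interval. -/
lemma measure_Ioo_eq_zero {α β : ℝ} {ρ : Measure ℝ} [IsFiniteMeasure ρ] (hα : 0 ≤ α)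
    {x₀ r c : ℝ} (hr : 0 < r) (hc : 0 < c)
    (h : ∀ x ∈ Ioo (x₀ - r) (x₀ + r), ∀ y ∈ Ioo 0 r,
      (nevFun α β ρ (x + y * I)).im ≤ c * y * ‖nevFun α β ρ (x + y * I)‖) :
    ρ (Ioo (x₀ - r) (x₀ + r)) = 0 := by
  set R := |x₀| + 2 * r with hR
  refine measure_Ioo_eq_zero_of_quadratic hr (C := 2 * (2 * (c * (α * R + |β|) +
    (c * R + (c * (1 + R ^ 2)) ^ 2 / 2) * ρ.real univ))) fun x hx y hy => ?_
  refine measure_Icc_le hy.1 ?_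
  have hzi : 0 < (x + y * I : ℂ).im := by simpa using hy.1
  have h1 := h x hx y hy
  have h2 := le_im_nevFun (β := β) (ρ := ρ) hα hzi
  have h3 : (x + y * I : ℂ).im = y := by simp
  rw [h3] at h2
  have hnorm : ‖(x + y * I : ℂ)‖ ≤ R := by
    refine (norm_add_le _ _).trans ?_
    rw [norm_mul, Complex.norm_I, mul_one, Complex.norm_real, Complex.norm_real, Real.norm_eq_abs,
      Real.norm_eq_abs, abs_of_pos hy.1]
    have h4 : |x - x₀| ≤ r := abs_le.2 ⟨by linarith [hx.1], by linarith [hx.2]⟩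
    have h5 := abs_add_le x₀ (x - x₀)
    rw [add_sub_cancel] at h5
    linarith [hy.2]
  have h4 := norm_nevFun_le (β := β) (ρ := ρ) hα hzi hnorm hc
  have h5 : ∫ t : ℝ, 1 / ‖(t : ℂ) - (x + y * I)‖ ^ 2 ∂ρ ≤ c * ‖nevFun α β ρ (x + y * I)‖ :=
    le_of_mul_le_mul_left ((h2.trans h1).trans_eq (by ring)) hy.1
  linarith

/-- For every `f ∈ 𝓗` with Nevanlinna representation `(α, β, ρ)`, the set
`Γ(f) = {x ∈ Ω(f) : f(x) < 0}` is Lebesgue regular. -/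
theorem gamma_lebesgue_regular (f : ℂ → ℂ) (α β : ℝ) (ρ : Measure ℝ)
    (hH : InH f) (hrep : NevRep f α β ρ) :
    LebesgueRegular (NevGamma α β ρ) := by
  obtain ⟨hα, hfin, hf⟩ := hrep
  intro x₀ ε hε hvol
  obtain ⟨r, hr, hrε⟩ : ∃ r, 0 < r ∧ 2 * r < ε := ⟨ε / 4, by positivity, by linarith⟩
  have hnull : ρ (Ioo (x₀ - r) (x₀ + r)) = 0 := by
    by_cases hρ : ρ = 0
    · simp [hρ]
    have hpos : ∀ z : ℂ, 0 < z.im → 0 < (nevFun α β ρ z).im := fun z hz => im_nevFun_pos hα hρ hz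
    have hdiff : DifferentiableOn ℂ (nevFun α β ρ) {z : ℂ | 0 < z.im} :=
      hH.1.congr fun z hz => (hf z hz).symm
    have hL : DifferentiableOn ℂ (fun z => Complex.log (-nevFun α β ρ z)) {z : ℂ | 0 < z.im} :=
      hdiff.neg.clog fun z hz => Or.inr (by
        rw [Pi.neg_apply, Complex.neg_im]
        exact neg_ne_zero.2 (hpos z hz).ne')
    refine measure_Ioo_eq_zero (α := α) (β := β) (c := 2 * Real.pi / r) hα hr (by positivity)
      fun x hx y hy => ?_
    have hzi : 0 < (x + y * I : ℂ).im := by simpa using hy.1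
    have hdecay := neg_im_le_of_tendsto hL (fun z _ => (Complex.neg_pi_lt_log_im _).le)
      (O := NevGamma α β ρ) (x := x) (r := r)
      (measure_mono_null (sdiff_subset_sdiff_left
        (Icc_subset_Ioo (by linarith [hx.1]) (by linarith [hx.2]))) hvol) ?_ hy.1 hy.2
    · rw [Complex.log_im] at hdecay
      have h1 := Complex.norm_mul_sin_arg (-nevFun α β ρ (x + y * I))
      rw [norm_neg, Complex.neg_im] at h1
      have harg : (-nevFun α β ρ (x + y * I)).arg < 0 :=
        Complex.arg_neg_iff.2 (by rw [Complex.neg_im]; linarith [hpos _ hzi])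
      have h2 := Real.sin_le (neg_nonneg.2 harg.le)
      rw [Real.sin_neg] at h2
      have h3 := mul_le_mul_of_nonneg_left (h2.trans hdecay) (norm_nonneg (nevFun α β ρ (x + y * I)))
      linarith
    · intro w hw
      have h0 : -nevFun α β ρ (w : ℂ) = ((-(nevFun α β ρ (w : ℂ)).re : ℝ) : ℂ) := by
        rw [nevFun_ofReal]
        simp
      have hneg : 0 < -(nevFun α β ρ (w : ℂ)).re := neg_pos.2 hw.2
      have hcont : ContinuousAt (fun z => (Complex.log (-nevFun α β ρ z)).im) (w : ℂ) := by
        refine Complex.continuous_im.continuousAt.comp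
          ((continuousAt_nevFun hw.1).neg.clog (Or.inl ?_))
        rw [Pi.neg_apply, h0, Complex.ofReal_re]
        exact hneg
      have hval : (Complex.log (-nevFun α β ρ (w : ℂ))).im = 0 := by
        rw [h0, Complex.log_im, Complex.arg_ofReal_of_nonneg hneg.le]
      have := hcont.tendsto
      rw [hval] at this
      exact this.mono_left nhdsWithin_le_nhds
  refine ⟨fun hσ => hσ _ (Ioo_mem_nhds (by linarith) (by linarith)) hnull, ?_⟩
  obtain ⟨x, hx, hxΓ⟩ : ∃ x ∈ Ioo x₀ (x₀ + r), x ∈ NevGamma α β ρ := by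
    by_contra! hcon
    have h0 : volume (Ioo x₀ (x₀ + r)) = 0 :=
      measure_mono_null (subset_sdiff.2
        ⟨Ioo_subset_Ioo (by linarith) (by linarith), disjoint_left.2 hcon⟩) hvol
    rw [Real.volume_Ioo, ENNReal.ofReal_eq_zero] at h0
    linarith
  exact (nevFun_re_mono hα hnull (by linarith) hx.1 hx.2).trans_lt hxΓ.2
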